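/- In the rational root system of type F_4 (for quaternionic E_8 with Heisenberg parabolic P of type E_7), with simple roots α_1=(0,1,-1,0), α_2=(0,0,1,-1), α_3=(0,0,0,1), α_4=(1/2,-1/2,-1/2,-1/2), the half-sum of positive roots ρ equals (8,3,2,1) scaled appropriately so that δ_P = |ν|^{29}, and the set [W_{M}\W/W_{M}] of double coset representatives of the Weyl group of the C_3 Levi in the Weyl group of F_4 has exactly five elements, of lengths 0, 1, 8, 5, and 15 (the last being the longest element of [W/W_M]). -/

import Mathlib

/-!
STATEMENT 8: In the rational root system of type F₄ (for quaternionic E₈ with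
Heisenberg parabolic P of E₇ Levi type), with simple roots α₁ = (0,1,-1,0),
α₂ = (0,0,1,-1), α₃ = (0,0,0,1), α₄ = (1/2,-1/2,-1/2,-1/2) and highest root
β = (1,1,0,0):
(a) the half-sum of positive roots, weighted by the root-space multiplicities
    (1 for long roots, 8 for short roots), is scaled so that δ_P = |ν|²⁹: the
    weighted sum of the roots occurring in the unipotent radical of P (i.e.
    those α > 0 with ⟨α, β⟩ > 0, together with β itself) equals 29·β;
(b) [W_M\W/W_M], the set of minimal-length double coset representatives for
    the Weyl group of the C₃ Levi (generated by s₂, s₃, s₄), has exactly five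
    elements, of lengths 0, 1, 8, 5 and 15, with reduced words [], [1],
    [1,2,3,4,2,3,2,1], [1,2,3,2,1], [1,2,3,4,2,3,1,2,3,4,1,2,3,2,1].
Here the length of w is #{α ∈ Φ⁺ : w(α) < 0}.
-/

namespace Stmt8

abbrev V := Fin 4 → ℚ

def dot (v w : V) : ℚ := ∑ i, v i * w i

def reflP (α : V) : Equiv.Perm V :=
  Function.Involutive.toPerm (fun v => v - (2 * dot v α / dot α α) • α) (by
    intro v
    by_cases h : dot α α = 0
    · simp [h]
    · have key : ∀ (c : ℚ) (w : V), dot (w - c • α) α = dot w α - c * dot α α := by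
        intro c w
        simp only [dot, Pi.sub_apply, Pi.smul_apply, smul_eq_mul, sub_mul,
          Finset.sum_sub_distrib, Finset.mul_sum]
        ring_nf
      simp only
      rw [key]
      have hc : 2 * (dot v α - 2 * dot v α / dot α α * dot α α) / dot α α
          = -(2 * dot v α / dot α α) := by field_simp; ring
      rw [hc]
      simp)

def α1 : V := ![0, 1, -1, 0]
def α2 : V := ![0, 0, 1, -1]
def α3 : V := ![0, 0, 0, 1]
def α4 : V := ![1/2, -1/2, -1/2, -1/2]

def s1 : Equiv.Perm V := reflP α1
def s2 : Equiv.Perm V := reflP α2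
def s3 : Equiv.Perm V := reflP α3
def s4 : Equiv.Perm V := reflP α4

def W : Subgroup (Equiv.Perm V) := Subgroup.closure {s1, s2, s3, s4}

/-- the 24 positive roots of F₄, as a list -/
def PosL : List V :=
  [![1,0,0,0], ![0,1,0,0], ![0,0,1,0], ![0,0,0,1],
   ![1,-1,0,0], ![1,1,0,0], ![1,0,-1,0], ![1,0,1,0], ![1,0,0,-1], ![1,0,0,1],
   ![0,1,-1,0], ![0,1,1,0], ![0,1,0,-1], ![0,1,0,1], ![0,0,1,-1], ![0,0,1,1],
   ![1/2,1/2,1/2,1/2], ![1/2,1/2,1/2,-1/2], ![1/2,1/2,-1/2,1/2], ![1/2,1/2,-1/2,-1/2],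
   ![1/2,-1/2,1/2,1/2], ![1/2,-1/2,1/2,-1/2], ![1/2,-1/2,-1/2,1/2], ![1/2,-1/2,-1/2,-1/2]]

def Pos : Set V := {v | v ∈ PosL}

/-- root-space multiplicity in quaternionic E₈: 1 for long roots, 8 for short -/
def m (α : V) : ℚ := if dot α α = 2 then 1 else 8

/-- the highest root -/
def β : V := ![1, 1, 0, 0]

/-- length of a Weyl group element -/
noncomputable def len (w : Equiv.Perm V) : ℕ :=
  Set.ncard {α : V | α ∈ Pos ∧ -(w α) ∈ Pos}

/-- the double coset condition for [W_M\W/W_M], M the C₃ Levi -/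
def DC (w : Equiv.Perm V) : Prop :=
  w ∈ W ∧ (w α2 ∈ Pos ∧ w α3 ∈ Pos ∧ w α4 ∈ Pos) ∧
    (w⁻¹ α2 ∈ Pos ∧ w⁻¹ α3 ∈ Pos ∧ w⁻¹ α4 ∈ Pos)

/-- the five claimed representatives, by their reduced words -/
def w0 : Equiv.Perm V := 1
def wa : Equiv.Perm V := s1
def wb : Equiv.Perm V := s1 * s2 * s3 * s4 * s2 * s3 * s2 * s1
def wc : Equiv.Perm V := s1 * s2 * s3 * s2 * s1
def wd : Equiv.Perm V :=
  s1 * s2 * s3 * s4 * s2 * s3 * s1 * s2 * s3 * s4 * s1 * s2 * s3 * s2 * s1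

/-- the 48 roots: the positive ones and their negatives -/
def RootL : List V := PosL ++ PosL.map (fun v => -v)

/-- twice the half-sum of the positive roots (without multiplicities) -/
def twoRho : V := ![11, 5, 3, 1]

theorem dot_four (v w : V) :
    dot v w = v 0 * w 0 + v 1 * w 1 + v 2 * w 2 + v 3 * w 3 := by
  simp [dot, Fin.sum_univ_four]

theorem reflP_apply (α v : V) : reflP α v = v - (2 * dot v α / dot α α) • α := rfl

theorem forall_V {p : V → Prop} (h : ∀ a b c d, p ![a, b, c, d]) (v : V) : p v := by
  have hv : v = ![v 0, v 1, v 2, v 3] := by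
    ext i
    fin_cases i <;> rfl
  rw [hv]
  exact h _ _ _ _

theorem s1_apply (a b c d : ℚ) : s1 ![a, b, c, d] = ![a, c, b, d] := by
  rw [s1, reflP_apply]
  simp [dot_four, α1]
  ring_nf
  simp

theorem s2_apply (a b c d : ℚ) : s2 ![a, b, c, d] = ![a, b, d, c] := by
  rw [s2, reflP_apply]
  simp [dot_four, α2]
  ring_nf
  simp

theorem s3_apply (a b c d : ℚ) : s3 ![a, b, c, d] = ![a, b, c, -d] := by
  rw [s3, reflP_apply]
  simp [dot_four, α3]
  ring_nf

theorem s4_apply (a b c d : ℚ) : s4 ![a, b, c, d] =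
    ![(a + b + c + d) / 2, (a + b - c - d) / 2, (a - b + c - d) / 2, (a - b - c + d) / 2] := by
  rw [s4, reflP_apply]
  simp [dot_four, α4]
  ring_nf
  simp

theorem wa_apply (a b c d : ℚ) : wa ![a, b, c, d] = ![a, c, b, d] := s1_apply a b c d

theorem wb_apply (a b c d : ℚ) : wb ![a, b, c, d] =
    ![(a - b + c + d) / 2, (-a - b + c - d) / 2, (a + b + c - d) / 2, (a - b - c - d) / 2] := by
  rw [wb]
  repeat rw [Equiv.Perm.mul_apply]
  simp only [s1_apply, s2_apply, s3_apply, s4_apply]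
  ring_nf

theorem wc_apply (a b c d : ℚ) : wc ![a, b, c, d] = ![a, -b, c, d] := by
  rw [wc]
  repeat rw [Equiv.Perm.mul_apply]
  simp only [s1_apply, s2_apply, s3_apply]

/-- `wd` is the reflection in the highest root. -/
theorem wd_apply (a b c d : ℚ) : wd ![a, b, c, d] = ![-b, -a, c, d] := by
  rw [wd]
  repeat rw [Equiv.Perm.mul_apply]
  simp only [s1_apply, s2_apply, s3_apply, s4_apply]
  ring_nf

theorem wa_inv : wa⁻¹ = wa :=
  inv_eq_of_mul_eq_one_left <| Equiv.ext <| forall_V fun a b c d => by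
    rw [Equiv.Perm.mul_apply, wa_apply, wa_apply, Equiv.Perm.one_apply]

theorem wb_inv : wb⁻¹ = wb :=
  inv_eq_of_mul_eq_one_left <| Equiv.ext <| forall_V fun a b c d => by
    rw [Equiv.Perm.mul_apply, wb_apply, wb_apply, Equiv.Perm.one_apply]
    ring_nf

theorem wc_inv : wc⁻¹ = wc :=
  inv_eq_of_mul_eq_one_left <| Equiv.ext <| forall_V fun a b c d => by
    rw [Equiv.Perm.mul_apply, wc_apply, wc_apply, Equiv.Perm.one_apply, neg_neg]

theorem wd_inv : wd⁻¹ = wd :=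
  inv_eq_of_mul_eq_one_left <| Equiv.ext <| forall_V fun a b c d => by
    rw [Equiv.Perm.mul_apply, wd_apply, wd_apply, Equiv.Perm.one_apply, neg_neg, neg_neg]

theorem s1_mem : s1 ∈ W := Subgroup.subset_closure (by simp)
theorem s2_mem : s2 ∈ W := Subgroup.subset_closure (by simp)
theorem s3_mem : s3 ∈ W := Subgroup.subset_closure (by simp)
theorem s4_mem : s4 ∈ W := Subgroup.subset_closure (by simp)

theorem wb_mem : wb ∈ W := by
  unfold wb
  repeat' apply W.mul_mem
  all_goals first | exact s1_mem | exact s2_mem | exact s3_mem | exact s4_mem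

theorem wc_mem : wc ∈ W := by
  unfold wc
  repeat' apply W.mul_mem
  all_goals first | exact s1_mem | exact s2_mem | exact s3_mem

theorem wd_mem : wd ∈ W := by
  unfold wd
  repeat' apply W.mul_mem
  all_goals first | exact s1_mem | exact s2_mem | exact s3_mem | exact s4_mem

/-- A permutation of `V` that is linear, isometric, and preserves the set of roots. -/
structure IsRootAut (w : Equiv.Perm V) : Prop where
  map_add : ∀ u v, w (u + v) = w u + w v
  map_smul : ∀ (c : ℚ) v, w (c • v) = c • w v
  map_dot : ∀ u v, dot (w u) (w v) = dot u v
  map_root : ∀ v, w v ∈ RootL ↔ v ∈ RootL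

theorem IsRootAut.one : IsRootAut 1 := by
  constructor <;> simp

theorem IsRootAut.mul {w w' : Equiv.Perm V} (h : IsRootAut w) (h' : IsRootAut w') :
    IsRootAut (w * w') where
  map_add u v := by simp [h.map_add, h'.map_add]
  map_smul c v := by simp [h.map_smul, h'.map_smul]
  map_dot u v := by simp [h.map_dot, h'.map_dot]
  map_root v := by simp [h.map_root, h'.map_root]

theorem IsRootAut.inv {w : Equiv.Perm V} (h : IsRootAut w) : IsRootAut w⁻¹ where
  map_add u v := w.injective (by simp [h.map_add])
  map_smul c v := w.injective (by simp [h.map_smul])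
  map_dot u v := by rw [← h.map_dot]; simp
  map_root v := by rw [← h.map_root]; simp

theorem isRootAut_reflP {α : V} (h0 : dot α α ≠ 0)
    (hroot : ∀ v ∈ RootL, reflP α v ∈ RootL) : IsRootAut (reflP α) where
  map_add u v := by
    ext i
    simp only [reflP_apply, dot_four, Pi.add_apply, Pi.sub_apply,
      Pi.smul_apply, smul_eq_mul]
    ring
  map_smul c v := by
    ext i
    simp only [reflP_apply, dot_four, Pi.sub_apply,
      Pi.smul_apply, smul_eq_mul]
    ring
  map_dot u v := by
    have key : dot (reflP α u) (reflP α v) = dot u v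
        - (2 * dot u α / dot α α) * dot v α - (2 * dot v α / dot α α) * dot u α
        + (2 * dot u α / dot α α) * (2 * dot v α / dot α α) * dot α α := by
      rw [reflP_apply, reflP_apply]
      generalize 2 * dot u α / dot α α = a
      generalize 2 * dot v α / dot α α = b
      simp only [dot_four, Pi.sub_apply, Pi.smul_apply, smul_eq_mul]
      ring
    rw [key]
    field_simp
    ring
  map_root v := by
    refine ⟨fun h => ?_, hroot v⟩
    have hv : reflP α (reflP α v) = v := Function.Involutive.toPerm_involutive _ v
    exact hv ▸ hroot _ h

theorem isRootAut_of_mem_W {w : Equiv.Perm V} (hw : w ∈ W) : IsRootAut w := by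
  induction hw using Subgroup.closure_induction with
  | mem x hx =>
    rcases hx with rfl | rfl | rfl | rfl
    all_goals exact isRootAut_reflP (by decide +kernel) (by decide +kernel)
  | one => exact .one
  | mul x y _ _ hx hy => exact hx.mul hy
  | inv x _ hx => exact hx.inv

theorem eq_combination (v : V) : v =
    (v 0 + v 1) • α1 + (2 * v 0 + v 1 + v 2) • α2
      + (3 * v 0 + v 1 + v 2 + v 3) • α3 + (2 * v 0) • α4 := by
  ext i
  fin_cases i <;> simp [α1, α2, α3, α4] <;> ring

theorem IsRootAut.ext {w w' : Equiv.Perm V} (h : IsRootAut w) (h' : IsRootAut w')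
    (h1 : w α1 = w' α1) (h2 : w α2 = w' α2) (h3 : w α3 = w' α3) (h4 : w α4 = w' α4) :
    w = w' := by
  ext1 v
  rw [eq_combination v]
  simp only [h.map_add, h'.map_add, h.map_smul, h'.map_smul, h1, h2, h3, h4]

theorem IsRootAut.map_twoRho {w : Equiv.Perm V} (h : IsRootAut w) :
    w twoRho = (16 : ℚ) • w α1 + (30 : ℚ) • w α2 + (42 : ℚ) • w α3 + (22 : ℚ) • w α4 := by
  simp only [← h.map_add, ← h.map_smul]
  congr 1
  decide +kernel

theorem dot_twoRho_pos : ∀ v ∈ PosL, 0 < dot v twoRho := by decide +kernel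

theorem dot_map_twoRho_pos {w : Equiv.Perm V} (h : IsRootAut w) {α : V} (hα : w⁻¹ α ∈ Pos) :
    0 < dot α (w twoRho) := by
  have := dot_twoRho_pos _ hα
  rwa [← h.map_dot, show w (w⁻¹ α) = α from w.apply_symm_apply α] at this

set_option synthInstance.maxHeartbeats 400000 in
set_option synthInstance.maxSize 2000 in
/-- Images of the simple roots under a minimal double coset representative. -/
theorem simple_images_mem :
    ∀ a2 ∈ PosL, dot a2 a2 = 2 →
    ∀ a3 ∈ PosL, dot a3 a3 = 1 → dot a2 a3 = -1 →
    ∀ a4 ∈ PosL, dot a4 a4 = 1 → dot a3 a4 = -1 / 2 → dot a2 a4 = 0 →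
    ∀ a1 ∈ RootL, dot a1 a1 = 2 → dot a1 a2 = -1 → dot a1 a3 = 0 → dot a1 a4 = 0 →
    0 < dot α2 ((16 : ℚ) • a1 + (30 : ℚ) • a2 + (42 : ℚ) • a3 + (22 : ℚ) • a4) →
    0 < dot α3 ((16 : ℚ) • a1 + (30 : ℚ) • a2 + (42 : ℚ) • a3 + (22 : ℚ) • a4) →
    0 < dot α4 ((16 : ℚ) • a1 + (30 : ℚ) • a2 + (42 : ℚ) • a3 + (22 : ℚ) • a4) →
    (a1 = α1 ∧ a2 = α2 ∧ a3 = α3 ∧ a4 = α4) ∨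
    (a1 = ![0, -1, 1, 0] ∧ a2 = ![0, 1, 0, -1] ∧ a3 = α3 ∧ a4 = α4) ∨
    (a1 = ![-1, -1, 0, 0] ∧ a2 = ![0, 1, 1, 0] ∧ a3 = α4 ∧ a4 = α3) ∨
    (a1 = ![0, -1, -1, 0] ∧ a2 = α2 ∧ a3 = α3 ∧ a4 = ![1/2, 1/2, -1/2, -1/2]) ∨
    (a1 = ![-1, 0, -1, 0] ∧ a2 = α2 ∧ a3 = α3 ∧ a4 = α4) := by
  decide +kernel

theorem eq_of_DC {w : Equiv.Perm V} (hw : DC w) :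
    w = w0 ∨ w = wa ∨ w = wb ∨ w = wc ∨ w = wd := by
  obtain ⟨hW, ⟨p2, p3, p4⟩, q2, q3, q4⟩ := hw
  have h := isRootAut_of_mem_W hW
  have key := simple_images_mem (w α2) p2 (by rw [h.map_dot]; decide +kernel)
    (w α3) p3 (by rw [h.map_dot]; decide +kernel) (by rw [h.map_dot]; decide +kernel)
    (w α4) p4 (by rw [h.map_dot]; decide +kernel) (by rw [h.map_dot]; decide +kernel)
    (by rw [h.map_dot]; decide +kernel)
    (w α1) ((h.map_root _).2 (by decide +kernel)) (by rw [h.map_dot]; decide +kernel)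
    (by rw [h.map_dot]; decide +kernel) (by rw [h.map_dot]; decide +kernel)
    (by rw [h.map_dot]; decide +kernel)
    (h.map_twoRho ▸ dot_map_twoRho_pos h q2) (h.map_twoRho ▸ dot_map_twoRho_pos h q3)
    (h.map_twoRho ▸ dot_map_twoRho_pos h q4)
  refine key.imp ?_ (Or.imp ?_ (Or.imp ?_ (Or.imp ?_ ?_))) <;> rintro ⟨h1, h2, h3, h4⟩
  · exact h.ext .one h1 h2 h3 h4
  · refine h.ext (w' := wa) (isRootAut_of_mem_W s1_mem) (h1.trans ?_) (h2.trans ?_) (h3.trans ?_)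
        (h4.trans ?_) <;>
      simp only [α1, α2, α3, α4, wa_apply]
  · refine h.ext (isRootAut_of_mem_W wb_mem) (h1.trans ?_) (h2.trans ?_) (h3.trans ?_)
        (h4.trans ?_) <;>
      simp only [α1, α2, α3, α4, wb_apply] <;> decide +kernel
  · refine h.ext (isRootAut_of_mem_W wc_mem) (h1.trans ?_) (h2.trans ?_) (h3.trans ?_)
        (h4.trans ?_) <;>
      simp only [α1, α2, α3, α4, wc_apply] <;> decide +kernel
  · refine h.ext (isRootAut_of_mem_W wd_mem) (h1.trans ?_) (h2.trans ?_) (h3.trans ?_)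
        (h4.trans ?_) <;>
      simp only [α1, α2, α3, α4, wd_apply] <;> decide +kernel

theorem mem_Pos {v : V} : v ∈ Pos ↔ v ∈ PosL := Iff.rfl

theorem DC_w0 : DC w0 := by
  refine ⟨W.one_mem, ?_, ?_⟩ <;>
    simp only [w0, inv_one, Equiv.Perm.one_apply, mem_Pos] <;> decide +kernel

theorem DC_wa : DC wa := by
  refine ⟨s1_mem, ?_, ?_⟩ <;> simp only [wa_inv, α2, α3, α4, wa_apply, mem_Pos] <;> decide +kernel

theorem DC_wb : DC wb := by
  refine ⟨wb_mem, ?_, ?_⟩ <;> simp only [wb_inv, α2, α3, α4, wb_apply, mem_Pos] <;> decide +kernel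

theorem DC_wc : DC wc := by
  refine ⟨wc_mem, ?_, ?_⟩ <;> simp only [wc_inv, α2, α3, α4, wc_apply, mem_Pos] <;> decide +kernel

theorem DC_wd : DC wd := by
  refine ⟨wd_mem, ?_, ?_⟩ <;> simp only [wd_inv, α2, α3, α4, wd_apply, mem_Pos] <;> decide +kernel

theorem setOf_DC : {w : Equiv.Perm V | DC w} = {w0, wa, wb, wc, wd} := by
  ext w
  simp only [Set.mem_ofPred_eq, Set.mem_insert_iff, Set.mem_singleton_iff]
  refine ⟨eq_of_DC, ?_⟩
  rintro (rfl | rfl | rfl | rfl | rfl)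
  exacts [DC_w0, DC_wa, DC_wb, DC_wc, DC_wd]

theorem len_eq_card {w : Equiv.Perm V} (f : V → V) (hf : ∀ v, w v = f v) :
    len w = (PosL.toFinset.filter fun α => -(f α) ∈ PosL).card := by
  rw [len, ← Set.ncard_coe_finset]
  congr 1
  ext α
  simp [mem_Pos, hf]

theorem len_w0 : len w0 = 0 := by
  rw [len_eq_card id fun _ => rfl]
  decide +kernel

theorem len_wa : len wa = 1 := by
  rw [len_eq_card (fun v => ![v 0, v 2, v 1, v 3]) (forall_V wa_apply)]
  decide +kernel

theorem len_wb : len wb = 8 := by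
  rw [len_eq_card (fun v => ![(v 0 - v 1 + v 2 + v 3) / 2, (-v 0 - v 1 + v 2 - v 3) / 2,
    (v 0 + v 1 + v 2 - v 3) / 2, (v 0 - v 1 - v 2 - v 3) / 2]) (forall_V wb_apply)]
  decide +kernel

theorem len_wc : len wc = 5 := by
  rw [len_eq_card (fun v => ![v 0, -v 1, v 2, v 3]) (forall_V wc_apply)]
  decide +kernel

theorem len_wd : len wd = 15 := by
  rw [len_eq_card (fun v => ![-v 1, -v 0, v 2, v 3]) (forall_V wd_apply)]
  decide +kernel

open scoped Classical in
theorem ncard_representatives : ({w0, wa, wb, wc, wd} : Set (Equiv.Perm V)).ncard = 5 := by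
  have hne : ∀ {w w' : Equiv.Perm V}, len w ≠ len w' → w ≠ w' := fun h e => h (e ▸ rfl)
  have hcard : ({w0, wa, wb, wc, wd} : Finset (Equiv.Perm V)).card = 5 := by
    repeat rw [Finset.card_insert_of_notMem]
    · simp
    all_goals
      simp only [Finset.mem_insert, Finset.mem_singleton, not_or]
      repeat' apply And.intro
      all_goals
        apply hne
        simp [len_w0, len_wa, len_wb, len_wc, len_wd]
  simpa [← Set.ncard_coe_finset] using hcard

theorem stmt8 :
    -- (a): δ_P = |ν|²⁹
    ((PosL.filter (fun α => decide (0 < dot α β))).map (fun α => m α • α)).sum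
        = (29 : ℚ) • β ∧
    -- (b): the double coset representatives and their lengths
    ({w : Equiv.Perm V | DC w} = {w0, wa, wb, wc, wd} ∧
      Set.ncard {w : Equiv.Perm V | DC w} = 5 ∧
      len w0 = 0 ∧ len wa = 1 ∧ len wb = 8 ∧ len wc = 5 ∧ len wd = 15) := by
  refine ⟨by decide +kernel, setOf_DC, ?_, len_w0, len_wa, len_wb, len_wc, len_wd⟩
  rw [setOf_DC, ncard_representatives]

end Stmt8
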